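/- arXiv:2404.12851 — 4 statements merged into one kernel-verified Lean document; each statement's English description precedes it below -/
import Mathlib

section
/- Let C and D be preadditive categories with zero objects, each equipped with a shift by ℤ. Let Ω be a spanning class of objects of C. Let Φ, Ψ : C ⥤ D be functors such that Φ admits a right adjoint Φᴿ commuting with the shifts, and such that the composite Θ := Ψ ⋙ Φᴿ : C ⥤ C admits a right adjoint Θᴿ commuting with the shifts. If Hom(Φ(L′), Ψ(L)⟦i⟧) = 0 for all objects L, L′ ∈ Ω and all i ∈ ℤ, then Hom(Φ(F), Ψ(G)) = 0 for all objects F, G of C; that is, the essential images of Φ and Ψ are semi-orthogonal to each other. -/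
open CategoryTheory Limits

/-- If `R` is a right adjoint commuting with the shift and every `Hom(L X, Y⟦i⟧)` is a
subsingleton, then so is every `Hom(X, (R Y)⟦i⟧)`. -/
lemma CategoryTheory.Adjunction.subsingleton_hom_shift {C D : Type*} [Category C] [Category D]
    [HasShift C ℤ] [HasShift D ℤ] {L : C ⥤ D} {R : D ⥤ C} (adj : L ⊣ R) [R.CommShift ℤ]
    {X : C} {Y : D} {i : ℤ} (h : Subsingleton (L.obj X ⟶ Y⟦i⟧)) :
    Subsingleton (X ⟶ (R.obj Y)⟦i⟧) :=
  (((R.commShiftIso i).app Y).symm.homToEquiv.trans (adj.homEquiv X (Y⟦i⟧)).symm).subsingleton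

/-- Orthogonality criterion via a spanning class: if `Φ, Ψ : C ⥤ D` are functors between
preadditive categories with zero objects and shifts by `ℤ`, `Φ` has a right adjoint `Φᴿ`
commuting with shifts, the composite `Θ = Ψ ⋙ Φᴿ` has a right adjoint commuting with shifts,
and `Hom(Φ L', (Ψ L)⟦i⟧) = 0` for all `L, L'` in a spanning class `Ω` and all `i : ℤ`,
then `Hom(Φ F, Ψ G) = 0` for all objects `F G : C`, i.e. the essential images of `Φ` and `Ψ`
are semi-orthogonal. -/
theorem semiorthogonal_of_spanning_class
    {C D : Type*} [Category C] [Category D]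
    [Preadditive C] [Preadditive D] [HasZeroObject C] [HasZeroObject D]
    [HasShift C ℤ] [HasShift D ℤ]
    (Ω : Set C)
    (hΩ : ∀ B : C, (∀ L ∈ Ω, ∀ i : ℤ, ∀ f : L ⟶ B⟦i⟧, f = 0) → IsZero B)
    (Φ Ψ : C ⥤ D) (ΦR : D ⥤ C) (adjΦ : Φ ⊣ ΦR) [ΦR.CommShift ℤ]
    (ΘR : C ⥤ C) (adjΘ : Ψ ⋙ ΦR ⊣ ΘR) [ΘR.CommShift ℤ]
    (h : ∀ L' ∈ Ω, ∀ L ∈ Ω, ∀ i : ℤ, ∀ f : Φ.obj L' ⟶ (Ψ.obj L)⟦i⟧, f = 0) :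
    ∀ (F G : C) (f : Φ.obj F ⟶ Ψ.obj G), f = 0 := by
  have hΘΩ : ∀ L ∈ Ω, IsZero ((Ψ ⋙ ΦR).obj L) := fun L hL => hΩ _ fun L' hL' i f =>
    (adjΦ.subsingleton_hom_shift (Y := Ψ.obj L)
      ⟨fun a b => (h L' hL' L hL i a).trans (h L' hL' L hL i b).symm⟩).elim f 0
  have hΘR : ∀ B : C, IsZero (ΘR.obj B) := fun B => hΩ _ fun L hL i f =>
    (adjΘ.subsingleton_hom_shift ⟨(hΘΩ L hL).eq_of_src⟩).elim f 0
  have hΘ : ∀ G : C, IsZero ((Ψ ⋙ ΦR).obj G) := fun G =>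
    (IsZero.iff_id_eq_zero _).2 ((adjΘ.homEquiv _ _).injective ((hΘR _).eq_of_tgt _ _))
  exact fun F G f => (adjΦ.homEquiv _ _).injective ((hΘ G).eq_of_tgt _ _)
end

section
/- Let k be a field and let d, l be integers with 0 ≤ l ≤ d. In the polynomial ring R = k[x₁,…,x_d], let 𝔪 = (x₁,…,x_d) be the ideal generated by all the variables and let I = (x_{l+1},…,x_d) + 𝔪² be the ideal generated by the last d − l variables together with 𝔪². Then the k-vector space I/(I·𝔪) has dimension d + (l² − l)/2. -/
open MvPolynomial

namespace ConormalFiber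

/-- Exponents of the generators of `(x_{l+1}, …, x_d) + 𝔪²`. -/
def genExponents (d l : ℕ) : Set (Fin d →₀ ℕ) :=
  {m | ∃ i : Fin d, l ≤ (i : ℕ) ∧ m = Finsupp.single i 1} ∪
    {m | ∃ i j : Fin d, m = Finsupp.single i 1 + Finsupp.single j 1}

/-- Exponents of the generators of `((x_{l+1}, …, x_d) + 𝔪²) · 𝔪`. -/
def genMulExponents (d l : ℕ) : Set (Fin d →₀ ℕ) :=
  {m | ∃ g ∈ genExponents d l, ∃ j : Fin d, m = g + Finsupp.single j 1}

theorem span_sup_sq_eq_span_monomial (k : Type*) [Field k] (d l : ℕ) :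
    Ideal.span {p : MvPolynomial (Fin d) k | ∃ i : Fin d, l ≤ (i : ℕ) ∧ p = X i} ⊔
      Ideal.span (Set.range X) ^ 2 =
    Ideal.span ((fun m => monomial m (1 : k)) '' genExponents d l) := by
  rw [pow_two, Ideal.span_mul_span', ← Ideal.span_union]
  congr 1
  ext p
  constructor
  · rintro (⟨i, hi, rfl⟩ | ⟨_, ⟨i, rfl⟩, _, ⟨j, rfl⟩, rfl⟩)
    · exact ⟨_, Or.inl ⟨i, hi, rfl⟩, rfl⟩
    · exact ⟨_, Or.inr ⟨i, j, rfl⟩, by simp [X, monomial_mul]⟩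
  · rintro ⟨_, (⟨i, hi, rfl⟩ | ⟨i, j, rfl⟩), rfl⟩
    · exact Or.inl ⟨i, hi, rfl⟩
    · exact Or.inr ⟨X i, ⟨i, rfl⟩, X j, ⟨j, rfl⟩, by simp [X, monomial_mul]⟩

theorem span_monomial_mul_span_X (k : Type*) [Field k] (d l : ℕ) :
    Ideal.span ((fun m => monomial m (1 : k)) '' genExponents d l) *
      Ideal.span (Set.range X) =
    Ideal.span ((fun m => monomial m (1 : k)) '' genMulExponents d l) := by
  rw [Ideal.span_mul_span']
  congr 1
  ext p
  constructor
  · rintro ⟨_, ⟨g, hg, rfl⟩, _, ⟨j, rfl⟩, rfl⟩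
    exact ⟨_, ⟨g, hg, j, rfl⟩, by simp [X, monomial_mul]⟩
  · rintro ⟨_, ⟨g, hg, j, rfl⟩, rfl⟩
    exact ⟨_, ⟨g, hg, rfl⟩, X j, ⟨j, rfl⟩, by simp [X, monomial_mul]⟩

/-- Exponents of the minimal monomial generators of `(x_{l+1}, …, x_d) + 𝔪²`: the variables
`x_i` with `i > l`, and the quadratic monomials in `x_1, …, x_l`. -/
noncomputable def minExponent {d l : ℕ} (hl : l ≤ d) :
    {i : Fin d // l ≤ (i : ℕ)} ⊕ Sym2 (Fin l) → (Fin d →₀ ℕ) :=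
  Sum.elim (fun i => Finsupp.single i.1 1)
    (Sym2.lift ⟨fun a b => Finsupp.single (Fin.castLE hl a) 1 + Finsupp.single (Fin.castLE hl b) 1,
      fun _ _ => add_comm _ _⟩)

theorem minExponent_mem {d l : ℕ} (hl : l ≤ d) (t) : minExponent hl t ∈ genExponents d l := by
  rcases t with i | s
  · exact Or.inl ⟨i.1, i.2, rfl⟩
  · induction s with | _ a b
    exact Or.inr ⟨_, _, rfl⟩

theorem minExponent_injective {d l : ℕ} (hl : l ≤ d) : Function.Injective (minExponent hl) := by
  rintro (i | s) (j | t) h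
  · have := Finsupp.single_left_injective (one_ne_zero) h
    rw [Subtype.ext this]
  · induction t with | _ a b
    have := congrArg Finsupp.degree h
    simp [minExponent] at this
  · induction s with | _ a b
    have := congrArg Finsupp.degree h
    simp [minExponent] at this
  · induction s with | _ a b
    induction t with | _ a' b'
    have h' := (Finsupp.single_add_single_eq_single_add_single one_ne_zero one_ne_zero).1 h
    simp only [Fin.castLE_inj] at h'
    simp only [Sum.inr.injEq, Sym2.eq_iff]
    simpa using h'

theorem exists_genMulExponents_le {d l : ℕ} (hl : l ≤ d) {m g : Fin d →₀ ℕ}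
    (hg : g ∈ genExponents d l) (hgm : g ≤ m) (hm : m ∉ Set.range (minExponent hl)) :
    ∃ b ∈ genMulExponents d l, b ≤ m := by
  have key : ∀ g ∈ genExponents d l, g ≤ m → m ≠ g → ∃ b ∈ genMulExponents d l, b ≤ m := by
    intro g hg hgm hne
    obtain ⟨r, rfl⟩ := exists_add_of_le hgm
    have hr : r ≠ 0 := by rintro rfl; simp at hne
    obtain ⟨j, hj⟩ := Finsupp.ne_iff.1 hr
    refine ⟨_, ⟨g, hg, j, rfl⟩, add_le_add_right ?_ g⟩
    rw [Finsupp.single_le_iff]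
    exact Nat.one_le_iff_ne_zero.2 hj
  have hlin : ∀ i : Fin d, l ≤ (i : ℕ) → Finsupp.single i 1 ≤ m →
      ∃ b ∈ genMulExponents d l, b ≤ m := fun i hi h =>
    key _ (Or.inl ⟨i, hi, rfl⟩) h fun e => hm ⟨Sum.inl ⟨i, hi⟩, e.symm⟩
  rcases hg with ⟨i, hi, rfl⟩ | ⟨i, j, rfl⟩
  · exact hlin i hi hgm
  · by_cases hi : l ≤ (i : ℕ)
    · exact hlin i hi (le_self_add.trans hgm)
    by_cases hj : l ≤ (j : ℕ)
    · exact hlin j hj (le_add_self.trans hgm)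
    exact key _ (Or.inr ⟨i, j, rfl⟩) hgm fun e =>
      hm ⟨Sum.inr s(⟨i, not_le.1 hi⟩, ⟨j, not_le.1 hj⟩), e.symm⟩

theorem not_genMulExponents_le_minExponent {d l : ℕ} (hl : l ≤ d) (t) {b : Fin d →₀ ℕ}
    (hb : b ∈ genMulExponents d l) : ¬ b ≤ minExponent hl t := by
  intro h
  have hdeg := Finsupp.degree_mono h
  obtain ⟨_, (⟨i, hi, rfl⟩ | ⟨i, i', rfl⟩), j, rfl⟩ := hb
  · rcases t with i' | s
    · simp [minExponent] at hdeg
    · induction s with | _ a b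
      have hi' := (Finsupp.single_le_iff.1 (le_self_add.trans h))
      have ha : Fin.castLE hl a ≠ i := fun e => by have := congrArg Fin.val e; simp at this; omega
      have hb : Fin.castLE hl b ≠ i := fun e => by have := congrArg Fin.val e; simp at this; omega
      simp [minExponent, ha, hb] at hi'
  · rcases t with i' | s
    · simp [minExponent] at hdeg
    · induction s with | _ a b
      simp [minExponent] at hdeg

theorem card_minExponent_index {d l : ℕ} (hl : l ≤ d) :
    Fintype.card ({i : Fin d // l ≤ (i : ℕ)} ⊕ Sym2 (Fin l)) = d + (l ^ 2 - l) / 2 := by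
  have h1 : Fintype.card {i : Fin d // l ≤ (i : ℕ)} = d - l := by
    have h := Fintype.card_subtype_compl (fun i : Fin d => (i : ℕ) < l)
    have h2 : Fintype.card {i : Fin d // (i : ℕ) < l} = l := by
      rw [← Fintype.card_congr (Fin.castLEquiv hl), Fintype.card_fin]
    simpa [h2] using h
  rw [Fintype.card_sum, Sym2.card, Fintype.card_fin, h1, Nat.choose_two_right]
  have h3 : (l + 1) * (l + 1 - 1) = (l ^ 2 - l) + 2 * l := by
    have : l ≤ l ^ 2 := Nat.le_self_pow two_ne_zero l
    zify [this]
    push_cast [Nat.add_sub_cancel]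
    ring
  rw [h3, Nat.add_mul_div_left _ _ two_pos]
  omega

end ConormalFiber

open ConormalFiber in
/-- Let `I = (x_{l+1}, …, x_d) + 𝔪²` in `R = k[x₁, …, x_d]`, where `𝔪 = (x₁, …, x_d)`.
Then `dim_k I/(I·𝔪) = d + (l² - l)/2`. -/
theorem finrank_ideal_quotient_ideal_mul_max (k : Type*) [Field k] (d l : ℕ) (hl : l ≤ d)
    (𝔪 I : Ideal (MvPolynomial (Fin d) k))
    (h𝔪 : 𝔪 = Ideal.span (Set.range X))
    (hI : I = Ideal.span {p | ∃ i : Fin d, l ≤ (i : ℕ) ∧ p = X i} ⊔ 𝔪 ^ 2) :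
    Module.finrank k (I ⧸ (Submodule.comap I.subtype (I * 𝔪 : Ideal _)))
      = d + (l ^ 2 - l) / 2 := by
  rw [h𝔪, span_sup_sq_eq_span_monomial] at hI
  have hIm : I * 𝔪 = Ideal.span ((fun m => monomial m (1 : k)) '' genMulExponents d l) := by
    rw [hI, h𝔪, span_monomial_mul_span_X]
  let φ : I →ₗ[k] ({i : Fin d // l ≤ (i : ℕ)} ⊕ Sym2 (Fin l) → k) :=
    LinearMap.pi fun t => lcoeff k (minExponent hl t) ∘ₗ I.subtype.restrictScalars k
  have hφ (p : I) (t) : φ p t = coeff (minExponent hl t) (p : MvPolynomial (Fin d) k) := rfl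
  have hsurj : Function.Surjective φ := by
    intro f
    have hmem : ∑ t, monomial (minExponent hl t) (f t) ∈ I := by
      refine Ideal.sum_mem _ fun t _ => ?_
      rw [hI, mem_ideal_span_monomial_image]
      intro m hm
      exact ⟨_, minExponent_mem hl t, (Finset.mem_singleton.1 (support_monomial_subset hm)).ge⟩
    refine ⟨⟨_, hmem⟩, funext fun t => ?_⟩
    classical
    simp only [hφ, coeff_sum, coeff_monomial, (minExponent_injective hl).eq_iff]
    simp only [Finset.sum_ite_eq', Finset.mem_univ, if_true]
  have hker : (Submodule.comap I.subtype (I * 𝔪 : Ideal _)).restrictScalars k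
      = LinearMap.ker φ := by
    ext p
    rw [Submodule.restrictScalars_mem, Submodule.mem_comap, LinearMap.mem_ker, hIm,
      Submodule.subtype_apply, mem_ideal_span_monomial_image]
    constructor
    · intro h
      funext t
      by_contra hne
      obtain ⟨b, hb, hle⟩ := h _ (mem_support_iff.2 hne)
      exact not_genMulExponents_le_minExponent hl t hb hle
    · intro h m hm
      obtain ⟨g, hg, hgm⟩ := mem_ideal_span_monomial_image.1 (hI.le p.2) m hm
      refine exists_genMulExponents_le hl hg hgm ?_
      rintro ⟨t, rfl⟩
      exact mem_support_iff.1 hm (congrFun h t)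
  rw [← (Submodule.Quotient.restrictScalarsEquiv k _).finrank_eq,
    (Submodule.quotEquivOfEq _ _ hker).finrank_eq,
    (φ.quotKerEquivOfSurjective hsurj).finrank_eq, Module.finrank_fintype_fun_eq_card,
    card_minExponent_index hl]
end

section
/- Let k be a field and let d, l be integers with 0 ≤ l ≤ d. In the polynomial ring R = k[x₁,…,x_d], let 𝔪 = (x₁,…,x_d) and I = (x_{l+1},…,x_d) + 𝔪². Then the short exact sequence of R-modules 0 → 𝔪²/(I·𝔪) → I/(I·𝔪) → I/𝔪² → 0 is split, so that I/(I·𝔪) ≅ I/𝔪² ⊕ 𝔪²/(I·𝔪) as R-modules; moreover dim_k I/𝔪² = d − l and dim_k 𝔪²/(I·𝔪) = (l² + l)/2. -/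
open MvPolynomial

theorem Finsupp.mem_finsuppAntidiag_iff_degree {σ : Type*} [DecidableEq σ] {S : Finset σ} {n : ℕ}
    {m : σ →₀ ℕ} : m ∈ S.finsuppAntidiag n ↔ m.degree = n ∧ m.support ⊆ S :=
  Finset.mem_finsuppAntidiag'

namespace MvPolynomial

section CommSemiring

variable {σ R : Type*} [CommSemiring R]

/-- An additive map between `MvPolynomial σ R`-modules that is `R`-linear is linear over
`MvPolynomial σ R` as soon as the variables annihilate both modules. -/
theorem map_smul_of_X_smul_eq_zero {M N : Type*} [AddCommMonoid M] [AddCommMonoid N]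
    [Module R M] [Module R N] [Module (MvPolynomial σ R) M] [Module (MvPolynomial σ R) N]
    [IsScalarTower R (MvPolynomial σ R) M] [IsScalarTower R (MvPolynomial σ R) N]
    (hM : ∀ (i : σ) (x : M), (X i : MvPolynomial σ R) • x = 0)
    (hN : ∀ (i : σ) (y : N), (X i : MvPolynomial σ R) • y = 0)
    (f : M →ₗ[R] N) (p : MvPolynomial σ R) (x : M) : f (p • x) = p • f x := by
  induction p using MvPolynomial.induction_on with
  | C a => rw [← algebraMap_eq, algebraMap_smul, algebraMap_smul, map_smul]
  | add p q hp hq => rw [add_smul, add_smul, map_add, hp, hq]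
  | mul_X p i _ => rw [mul_smul, mul_smul, hM, hN, smul_zero, smul_zero, map_zero]

theorem coeff_eq_zero_of_mem_span_X_image {S : Set σ} {p : MvPolynomial σ R}
    (hp : p ∈ Ideal.span (X '' S) ⊔ idealOfVars σ R ^ 2) {m : σ →₀ ℕ}
    (hm : m.degree < 2) (hS : ∀ i ∈ S, m i = 0) : coeff m p = 0 := by
  obtain ⟨a, ha, b, hb, rfl⟩ := Submodule.mem_sup.1 hp
  rw [coeff_add, (mem_pow_idealOfVars_iff' 2 b).1 hb m hm, add_zero]
  by_contra h
  obtain ⟨i, hi, hne⟩ := mem_ideal_span_X_image.1 ha m (mem_support_iff.2 h)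
  exact hne (hS i hi)

theorem coeff_eq_zero_of_mem_mul_idealOfVars {S : Set σ} {p : MvPolynomial σ R}
    (hp : p ∈ (Ideal.span (X '' S) ⊔ idealOfVars σ R ^ 2) * idealOfVars σ R) {m : σ →₀ ℕ}
    (hm : m.degree ≤ 2) (hS : ∀ i ∈ S, m i = 0) : coeff m p = 0 := by
  classical
  induction hp using Submodule.mul_induction_on' with
  | add x _ y _ hx hy => rw [coeff_add, hx, hy, add_zero]
  | mem_mul_mem a ha b hb =>
    rw [coeff_mul]
    refine Finset.sum_eq_zero fun ⟨u, v⟩ huv => ?_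
    rw [Finset.HasAntidiagonal.mem_antidiagonal] at huv
    dsimp only at huv ⊢
    subst huv
    rw [map_add] at hm
    rcases Nat.eq_zero_or_pos v.degree with hv | hv
    · rw [← pow_one (idealOfVars σ R)] at hb
      rw [(mem_pow_idealOfVars_iff' 1 b).1 hb v (by omega), mul_zero]
    · rw [coeff_eq_zero_of_mem_span_X_image ha (by omega) fun i hi => ?_, zero_mul]
      exact (add_eq_zero.1 (hS i hi)).1

theorem monomial_mem_mul_idealOfVars_of_mem {S : Set σ} {m : σ →₀ ℕ} {i : σ}
    (hi : i ∈ S) (hmi : m i ≠ 0) (hm : 2 ≤ m.degree) (c : R) :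
    monomial m c ∈ (Ideal.span (X '' S) ⊔ idealOfVars σ R ^ 2) * idealOfVars σ R := by
  rcases eq_or_ne c 0 with rfl | hc
  · simp
  obtain ⟨u, rfl⟩ := exists_add_of_le
    (show Finsupp.single i 1 ≤ m by simpa [Nat.one_le_iff_ne_zero] using hmi)
  have hu : monomial u c ∈ idealOfVars σ R ^ 1 :=
    (monomial_mem_pow_idealOfVars_iff 1 u hc).2 (by simp at hm; omega)
  rw [pow_one] at hu
  rw [← one_mul c, ← monomial_mul]
  exact Ideal.mul_mem_mul
    (Ideal.mem_sup_left (Ideal.subset_span (Set.mem_image_of_mem X hi))) hu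

theorem pow_three_le_mul_idealOfVars (S : Set σ) :
    idealOfVars σ R ^ 3 ≤ (Ideal.span (X '' S) ⊔ idealOfVars σ R ^ 2) * idealOfVars σ R := by
  rw [pow_succ]
  exact Ideal.mul_mono_left le_sup_right

theorem monomial_mem_span_X_image {S : Set σ} {m : σ →₀ ℕ} {i : σ} (hi : i ∈ S)
    (hmi : m i ≠ 0) (c : R) : monomial m c ∈ Ideal.span (X '' S) := by
  classical
  refine mem_ideal_span_X_image.2 fun n hn => ⟨i, hi, ?_⟩
  rwa [Finset.mem_singleton.1 (support_monomial_subset hn)]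

theorem mem_sq_idealOfVars_iff_of_mem [DecidableEq σ] {S : Finset σ} {p : MvPolynomial σ R}
    (hp : p ∈ Ideal.span (X '' (S : Set σ)) ⊔ idealOfVars σ R ^ 2) :
    p ∈ idealOfVars σ R ^ 2 ↔ ∀ m ∈ S.finsuppAntidiag 1, coeff m p = 0 := by
  rw [mem_pow_idealOfVars_iff']
  constructor
  · intro h m hm
    rw [Finsupp.mem_finsuppAntidiag_iff_degree] at hm
    exact h m (by omega)
  · intro h m hm
    by_cases hS : ∀ i ∈ (S : Set σ), m i = 0
    · exact coeff_eq_zero_of_mem_span_X_image hp hm hS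
    · push Not at hS
      obtain ⟨i, hi, hmi⟩ := hS
      obtain ⟨u, rfl⟩ := exists_add_of_le
        (show Finsupp.single i 1 ≤ m by simpa [Nat.one_le_iff_ne_zero] using hmi)
      obtain rfl : u = 0 := by
        rw [← Finsupp.degree_eq_zero_iff]
        simp at hm
        omega
      refine h _ ?_
      rw [Finsupp.mem_finsuppAntidiag_iff_degree]
      simp [Finset.mem_coe.1 hi]

theorem mem_mul_idealOfVars_iff_of_mem_sq [Fintype σ] [DecidableEq σ] {S : Finset σ}
    {p : MvPolynomial σ R} (hp : p ∈ idealOfVars σ R ^ 2) :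
    p ∈ (Ideal.span (X '' (S : Set σ)) ⊔ idealOfVars σ R ^ 2) * idealOfVars σ R ↔
      ∀ m ∈ Sᶜ.finsuppAntidiag 2, coeff m p = 0 := by
  constructor
  · intro h m hm
    rw [Finsupp.mem_finsuppAntidiag_iff_degree] at hm
    refine coeff_eq_zero_of_mem_mul_idealOfVars h hm.1.le fun i hi => ?_
    by_contra hmi
    exact Finset.mem_compl.1 (hm.2 (Finsupp.mem_support_iff.2 hmi)) hi
  · intro h
    rw [p.as_sum]
    refine Ideal.sum_mem _ fun m hm => ?_
    have hdeg := (mem_pow_idealOfVars_iff 2 p).1 hp m hm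
    by_cases hS : ∃ i ∈ S, m i ≠ 0
    · obtain ⟨i, hi, hmi⟩ := hS
      exact monomial_mem_mul_idealOfVars_of_mem (Finset.mem_coe.2 hi) hmi hdeg _
    · push Not at hS
      refine pow_three_le_mul_idealOfVars _
        ((monomial_mem_pow_idealOfVars_iff 3 m (mem_support_iff.1 hm)).2 ?_)
      refine lt_of_le_of_ne hdeg fun h2 => mem_support_iff.1 hm (h m ?_)
      rw [Finsupp.mem_finsuppAntidiag_iff_degree]
      refine ⟨h2.symm, fun i hi => Finset.mem_compl.2 fun hiS => ?_⟩
      exact Finsupp.mem_support_iff.1 hi (hS i hiS)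

end CommSemiring

/-- If `J` contains the monomials with exponents in `T`, and an element of `J` lies in `K` exactly
when its coefficients at `T` vanish, then these monomials form a basis of `J` modulo `K`. -/
theorem finrank_quotient_comap_eq_card {σ k : Type*} [Field k] (J K : Ideal (MvPolynomial σ k))
    (T : Finset (σ →₀ ℕ)) (hT : ∀ m ∈ T, ∀ c : k, monomial m c ∈ J)
    (hK : ∀ p ∈ J, p ∈ K ↔ ∀ m ∈ T, coeff m p = 0) :
    Module.finrank k (J ⧸ Submodule.comap J.subtype K) = T.card := by
  classical
  let φ : J →ₗ[k] T → k :=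
    LinearMap.pi fun m => (lcoeff k (m : σ →₀ ℕ)).comp (J.subtype.restrictScalars k)
  have hφ (p : J) (m : T) : φ p m = coeff (m : σ →₀ ℕ) (p : MvPolynomial σ k) := rfl
  have hker : LinearMap.ker φ = (Submodule.comap J.subtype K).restrictScalars k := by
    ext p
    rw [LinearMap.mem_ker, Submodule.restrictScalars_mem, Submodule.mem_comap,
      Submodule.subtype_apply, hK p p.2]
    exact _root_.funext_iff.trans Subtype.forall
  have hsurj : Function.Surjective φ := by
    intro f
    refine ⟨⟨∑ m : T, monomial (m : σ →₀ ℕ) (f m),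
      Ideal.sum_mem _ fun m _ => hT m m.2 _⟩, ?_⟩
    ext m
    simp [hφ, coeff_sum, coeff_monomial]
  rw [← (Submodule.Quotient.restrictScalarsEquiv k _).finrank_eq, ← hker,
    (φ.quotKerEquivOfSurjective hsurj).finrank_eq, Module.finrank_fintype_fun_eq_card,
    Fintype.card_coe]

end MvPolynomial

/-- Let `I = (x_{l+1}, …, x_d) + 𝔪²` in `R = k[x₁, …, x_d]`, where `𝔪 = (x₁, …, x_d)`.
Then the short exact sequence of `R`-modules `0 → 𝔪²/(I·𝔪) → I/(I·𝔪) → I/𝔪² → 0`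
is split, so `I/(I·𝔪) ≅ I/𝔪² ⊕ 𝔪²/(I·𝔪)` as `R`-modules; moreover
`dim_k I/𝔪² = d - l` and `dim_k 𝔪²/(I·𝔪) = (l² + l)/2`. -/
theorem ideal_quotient_sequence_split (k : Type*) [Field k] (d l : ℕ) (hl : l ≤ d)
    (𝔪 I : Ideal (MvPolynomial (Fin d) k))
    (h𝔪 : 𝔪 = Ideal.span (Set.range X))
    (hI : I = Ideal.span {p | ∃ i : Fin d, l ≤ (i : ℕ) ∧ p = X i} ⊔ 𝔪 ^ 2)
    -- the (automatic) inclusions `I·𝔪 ⊆ 𝔪² ⊆ I`, giving the maps of the sequence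
    (h1 : (I * 𝔪 : Ideal (MvPolynomial (Fin d) k)) ≤ 𝔪 ^ 2)
    (h2 : (𝔪 ^ 2 : Ideal (MvPolynomial (Fin d) k)) ≤ I) :
    -- the projection `I/(I·𝔪) → I/𝔪²` admits a section
    (∃ s : (I ⧸ Submodule.comap I.subtype (𝔪 ^ 2 : Ideal _)) →ₗ[MvPolynomial (Fin d) k]
        (I ⧸ Submodule.comap I.subtype (I * 𝔪 : Ideal _)),
      (Submodule.mapQ (Submodule.comap I.subtype (I * 𝔪 : Ideal _))
          (Submodule.comap I.subtype (𝔪 ^ 2 : Ideal _)) LinearMap.id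
          (fun x hx => h1 hx)).comp s = LinearMap.id) ∧
    -- hence `I/(I·𝔪) ≅ I/𝔪² ⊕ 𝔪²/(I·𝔪)` as `R`-modules
    Nonempty ((I ⧸ Submodule.comap I.subtype (I * 𝔪 : Ideal _)) ≃ₗ[MvPolynomial (Fin d) k]
      (I ⧸ Submodule.comap I.subtype (𝔪 ^ 2 : Ideal _)) ×
      ((𝔪 ^ 2 : Ideal (MvPolynomial (Fin d) k)) ⧸
        Submodule.comap (𝔪 ^ 2 : Ideal (MvPolynomial (Fin d) k)).subtype
          (I * 𝔪 : Ideal _))) ∧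
    -- and the dimension counts
    Module.finrank k (I ⧸ Submodule.comap I.subtype (𝔪 ^ 2 : Ideal _)) = d - l ∧
    Module.finrank k ((𝔪 ^ 2 : Ideal (MvPolynomial (Fin d) k)) ⧸
        Submodule.comap (𝔪 ^ 2 : Ideal (MvPolynomial (Fin d) k)).subtype
          (I * 𝔪 : Ideal _)) = (l ^ 2 + l) / 2 := by
  have hS : {p : MvPolynomial (Fin d) k | ∃ i : Fin d, l ≤ (i : ℕ) ∧ p = X i} =
      X '' ((Finset.univ.filter fun i : Fin d => l ≤ (i : ℕ) : Finset (Fin d)) :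
        Set (Fin d)) := by
    ext p
    simp [eq_comm]
  have hcard : (Finset.univ.filter fun i : Fin d => l ≤ (i : ℕ)).card = d - l := by
    rw [← Finset.card_map Fin.valEmbedding, ← Nat.card_Ico l d]
    congr 1
    ext n
    simp only [Finset.mem_map, Finset.mem_filter, Finset.mem_univ, true_and,
      Fin.valEmbedding_apply, Finset.mem_Ico]
    exact ⟨fun ⟨i, hi, hin⟩ => hin ▸ ⟨hi, i.2⟩, fun ⟨hn, hnd⟩ => ⟨⟨n, hnd⟩, hn, rfl⟩⟩
  rw [hS] at hI
  generalize (Finset.univ.filter fun i : Fin d => l ≤ (i : ℕ)) = S at hI hcard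
  have hX (i : Fin d) : X i ∈ 𝔪 := h𝔪 ▸ Ideal.subset_span (Set.mem_range_self i)
  have hle : I ≤ 𝔪 := by
    rw [hI]
    refine sup_le (Ideal.span_le.2 ?_) (Ideal.pow_le_self two_ne_zero)
    rintro _ ⟨i, _, rfl⟩
    exact hX i
  have hM (i : Fin d) (x : I ⧸ Submodule.comap I.subtype (I * 𝔪 : Ideal _)) :
      (X i : MvPolynomial (Fin d) k) • x = 0 := by
    obtain ⟨x, rfl⟩ := Submodule.Quotient.mk_surjective _ x
    rw [← Submodule.Quotient.mk_smul, Submodule.Quotient.mk_eq_zero]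
    change X i * (x : MvPolynomial (Fin d) k) ∈ I * 𝔪
    rw [mul_comm (X i)]
    exact Ideal.mul_mem_mul x.2 (hX i)
  have hN (i : Fin d) (x : I ⧸ Submodule.comap I.subtype (𝔪 ^ 2 : Ideal _)) :
      (X i : MvPolynomial (Fin d) k) • x = 0 := by
    obtain ⟨x, rfl⟩ := Submodule.Quotient.mk_surjective _ x
    rw [← Submodule.Quotient.mk_smul, Submodule.Quotient.mk_eq_zero]
    change X i * (x : MvPolynomial (Fin d) k) ∈ 𝔪 ^ 2
    rw [sq]
    exact Ideal.mul_mem_mul (hX i) (hle x.2)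
  have hcomap : Submodule.comap I.subtype (I * 𝔪 : Ideal _) ≤
      Submodule.comap LinearMap.id (Submodule.comap I.subtype (𝔪 ^ 2 : Ideal _)) :=
    Submodule.comap_mono h1
  let g := Submodule.mapQ (Submodule.comap I.subtype (I * 𝔪 : Ideal _))
    (Submodule.comap I.subtype (𝔪 ^ 2 : Ideal _)) LinearMap.id hcomap
  have hgs : Function.Surjective g := by
    intro x
    obtain ⟨x, rfl⟩ := Submodule.Quotient.mk_surjective _ x
    exact ⟨Submodule.Quotient.mk x, rfl⟩
  obtain ⟨s, hs⟩ : ∃ s, g ∘ₗ s = LinearMap.id := by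
    obtain ⟨s, hs⟩ := (g.restrictScalars k).exists_rightInverse_of_surjective
      (LinearMap.range_eq_top.2 hgs)
    exact ⟨{ s with map_smul' := map_smul_of_X_smul_eq_zero hN hM s },
      LinearMap.ext fun x => LinearMap.congr_fun hs x⟩
  refine ⟨⟨s, hs⟩, ?_, ?_, ?_⟩
  · let f := Submodule.mapQ
      (Submodule.comap (𝔪 ^ 2 : Ideal (MvPolynomial (Fin d) k)).subtype (I * 𝔪 : Ideal _))
      (Submodule.comap I.subtype (I * 𝔪 : Ideal _)) (Submodule.inclusion h2) fun x hx => hx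
    have hf : Function.Injective f := by
      rw [injective_iff_map_eq_zero]
      intro x hx
      obtain ⟨x, rfl⟩ := Submodule.Quotient.mk_surjective _ x
      exact (Submodule.Quotient.mk_eq_zero _).2
        ((Submodule.Quotient.mk_eq_zero (Submodule.comap I.subtype (I * 𝔪 : Ideal _))).1 hx :)
    have hfg : Function.Exact f g := by
      intro x
      obtain ⟨x, rfl⟩ := Submodule.Quotient.mk_surjective _ x
      constructor
      · intro hx
        have hx' : (x : MvPolynomial (Fin d) k) ∈ 𝔪 ^ 2 :=
          (Submodule.Quotient.mk_eq_zero (Submodule.comap I.subtype (𝔪 ^ 2 : Ideal _))).1 hx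
        exact ⟨Submodule.Quotient.mk ⟨x, hx'⟩, rfl⟩
      · rintro ⟨y, hy⟩
        obtain ⟨y, rfl⟩ := Submodule.Quotient.mk_surjective _ y
        rw [← hy]
        exact (Submodule.Quotient.mk_eq_zero
          (Submodule.comap I.subtype (𝔪 ^ 2 : Ideal _))).2 y.2
    exact ⟨(hfg.splitSurjectiveEquiv hf ⟨s, hs⟩).1.trans (LinearEquiv.prodComm _ _ _)⟩
  · rw [finrank_quotient_comap_eq_card I (𝔪 ^ 2) (S.finsuppAntidiag 1),
      Finset.card_finsuppAntidiag_nat_eq_choose, hcard]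
    · simp
    · intro m hm c
      rw [Finsupp.mem_finsuppAntidiag_iff_degree] at hm
      obtain ⟨i, hi⟩ := Finsupp.support_nonempty_iff.2 (show m ≠ 0 by
        rintro rfl
        simp at hm)
      rw [hI]
      exact Ideal.mem_sup_left (monomial_mem_span_X_image (Finset.mem_coe.2 (hm.2 hi))
        (Finsupp.mem_support_iff.1 hi) c)
    · subst hI h𝔪
      exact fun p hp => mem_sq_idealOfVars_iff_of_mem hp
  · rw [finrank_quotient_comap_eq_card (𝔪 ^ 2) (I * 𝔪) (Sᶜ.finsuppAntidiag 2),
      Finset.card_finsuppAntidiag_nat_eq_choose, Finset.card_compl, hcard, Fintype.card_fin,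
      Nat.sub_sub_self hl, Nat.choose_two_right]
    · congr 1
      simp
      ring
    · intro m hm c
      rw [Finsupp.mem_finsuppAntidiag_iff_degree] at hm
      rw [h𝔪, mem_pow_idealOfVars_iff]
      intro n hn
      rw [Finset.mem_singleton.1 (support_monomial_subset hn), hm.1]
    · subst hI h𝔪
      exact fun p hp => mem_mul_idealOfVars_iff_of_mem_sq hp
end

section
/- Let d ≥ 2 be an integer and let α₁ ≥ α₂ ≥ 0 and β₁ ≥ β₂ ≥ 0 be integers with α₁ ≤ d − 2 and β₁ ≤ d − 2. Assume (α₁, α₂) ≠ (β₁, β₂) and β₁ + β₂ ≤ α₁ + α₂. Then for every integer γ with 0 ≤ γ ≤ min(α₁ − α₂, β₁ − β₂), one has 1 ≤ α₁ − β₂ − γ ≤ d − 2. -/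
/-- For Young diagrams `α = (α₁, α₂)` and `β = (β₁, β₂)` with at most two rows and at most
`d - 2` columns, if `α ≠ β` and `|β| ≤ |α|`, then every first entry `α₁ - β₂ - γ`
(for `0 ≤ γ ≤ min (α₁ - α₂) (β₁ - β₂)`) occurring in the Littlewood–Richardson/Pieri
decomposition of `Σ^α Q^∨ ⊗ Σ^{-β} Q^∨` satisfies `1 ≤ α₁ - β₂ - γ ≤ d - 2`. -/
theorem pieri_first_entry_bounds (d α₁ α₂ β₁ β₂ : ℤ) (hd : 2 ≤ d)
    (hα21 : α₂ ≤ α₁) (hα0 : 0 ≤ α₂) (hα1 : α₁ ≤ d - 2)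
    (hβ21 : β₂ ≤ β₁) (hβ0 : 0 ≤ β₂) (hβ1 : β₁ ≤ d - 2)
    (hne : (α₁, α₂) ≠ (β₁, β₂)) (hsum : β₁ + β₂ ≤ α₁ + α₂) :
    ∀ γ : ℤ, 0 ≤ γ → γ ≤ min (α₁ - α₂) (β₁ - β₂) →
      1 ≤ α₁ - β₂ - γ ∧ α₁ - β₂ - γ ≤ d - 2 := by
  intro γ hγ0 hγ
  rw [ne_eq, Prod.mk.injEq] at hne
  omega
end
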